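/- arXiv:math/0410085 — 2 statements merged into one kernel-verified Lean document; each statement's English description precedes it below -/
import Mathlib

section
/- Let k and l be even nonnegative integers and let n be a positive integer. Then E_k ≡ E_l (mod 2^n) if and only if k ≡ l (mod 2^n). -/
/-- The Euler numbers: `E 0 = 1` and
`E n = -∑_{0 ≤ k < n, n - k even} (n choose k) * E k` for `n ≥ 1`. -/
def eulerNumber : ℕ → ℤ
  | 0 => 1
  | n + 1 =>
    -∑ k ∈ (Finset.range (n + 1)).attach,
      if Even (n + 1 - k.1) then ((n + 1).choose k.1 : ℤ) * eulerNumber k.1 else 0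
  decreasing_by exact Finset.mem_range.mp k.2

/-- The Euler polynomial `E_n(x) = ∑_{k=0}^n (n choose k) (E_k / 2^k) (x - 1/2)^(n-k)`. -/
noncomputable def eulerPoly (n : ℕ) : Polynomial ℚ :=
  ∑ k ∈ Finset.range (n + 1),
    Polynomial.C ((n.choose k : ℚ) * (eulerNumber k : ℚ) / 2 ^ k) *
      (Polynomial.X - Polynomial.C (1 / 2)) ^ (n - k)

/-- The linear functional on `ℤ[X]` sending `X ^ n` to the Euler number `E n`. -/
noncomputable def eulerFunctional : Polynomial ℤ →ₗ[ℤ] ℤ :=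
  Polynomial.lsum fun n => eulerNumber n • LinearMap.id

namespace eulerFunctional

open Polynomial

lemma apply_X_pow (n : ℕ) : eulerFunctional (X ^ n) = eulerNumber n := by
  simp [eulerFunctional, ← monomial_one_right_eq_X_pow]

lemma apply_intCast_mul (a : ℤ) (f : ℤ[X]) :
    eulerFunctional ((a : ℤ[X]) * f) = a * eulerFunctional f := by
  rw [← zsmul_eq_mul, map_zsmul, smul_eq_mul]

end eulerFunctional

/-- The defining recurrence, with the last term included in the sum. -/
lemma sum_choose_mul_eulerNumber_eq_zero {n : ℕ} (hn : n ≠ 0) :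
    ∑ k ∈ Finset.range (n + 1),
      (if Even (n - k) then (n.choose k : ℤ) * eulerNumber k else 0) = 0 := by
  obtain ⟨m, rfl⟩ := Nat.exists_eq_succ_of_ne_zero hn
  rw [Finset.sum_range_succ]
  have h : eulerNumber (m + 1) = -∑ k ∈ Finset.range (m + 1),
      if Even (m + 1 - k) then ((m + 1).choose k : ℤ) * eulerNumber k else 0 := by
    rw [eulerNumber, ← Finset.sum_attach (Finset.range (m + 1))]
  simp [h]

namespace eulerFunctional

open Polynomial

lemma apply_add_one_pow_add_sub_one_pow {n : ℕ} (hn : n ≠ 0) :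
    eulerFunctional ((X + 1) ^ n + (X - 1) ^ n) = 0 := by
  have key : ((X + 1) ^ n + (X - 1) ^ n : ℤ[X]) = ∑ k ∈ Finset.range (n + 1),
      (if Even (n - k) then (2 * n.choose k : ℤ) else 0) • X ^ k := by
    rw [sub_eq_add_neg, add_pow, add_pow, ← Finset.sum_add_distrib]
    refine Finset.sum_congr rfl fun k _ => ?_
    split_ifs with h
    · rw [h.neg_one_pow, zsmul_eq_mul]
      push_cast
      ring
    · rw [(Nat.not_even_iff_odd.mp h).neg_one_pow]
      simp
  rw [key, map_sum]
  have := congrArg (2 * ·) (sum_choose_mul_eulerNumber_eq_zero hn)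
  simp only [Finset.mul_sum, mul_zero] at this
  refine (Finset.sum_congr rfl fun k _ => ?_).trans this
  rw [map_zsmul, apply_X_pow, smul_eq_mul]
  split_ifs <;> ring

/-- The integral span of the products `4 ^ a * (X ^ 2 - 1) ^ b` with `a + b = n`. -/
noncomputable def homogeneousSpan (n : ℕ) : Submodule ℤ ℤ[X] :=
  Submodule.span ℤ {f | ∃ a b : ℕ, a + b = n ∧ f = ((4 ^ a : ℤ) : ℤ[X]) * (X ^ 2 - 1) ^ b}

lemma four_mul_mem {n : ℕ} {f : ℤ[X]} (hf : f ∈ homogeneousSpan n) :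
    4 * f ∈ homogeneousSpan (n + 1) := by
  induction hf using Submodule.span_induction with
  | mem f h =>
    obtain ⟨a, b, rfl, rfl⟩ := h
    refine Submodule.subset_span ⟨a + 1, b, by ring, ?_⟩
    push_cast
    ring
  | zero => simp
  | add f g _ _ hf hg => rw [mul_add]; exact add_mem hf hg
  | smul c f _ hf => rw [mul_smul_comm]; exact Submodule.smul_mem _ c hf

lemma sq_sub_one_mul_mem {n : ℕ} {f : ℤ[X]} (hf : f ∈ homogeneousSpan n) :
    (X ^ 2 - 1) * f ∈ homogeneousSpan (n + 1) := by
  induction hf using Submodule.span_induction with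
  | mem f h =>
    obtain ⟨a, b, rfl, rfl⟩ := h
    refine Submodule.subset_span ⟨a, b + 1, by ring, ?_⟩
    ring
  | zero => simp
  | add f g _ _ hf hg => rw [mul_add]; exact add_mem hf hg
  | smul c f _ hf => rw [mul_smul_comm]; exact Submodule.smul_mem _ c hf

lemma sq_sub_one_pow_mem (n : ℕ) : ((X ^ 2 - 1) ^ n : ℤ[X]) ∈ homogeneousSpan n :=
  Submodule.subset_span ⟨0, n, by simp, by simp⟩

lemma exists_mem_homogeneousSpan (n : ℕ) : ∃ s ∈ homogeneousSpan n,
    ((X + 1) ^ (2 * (n + 1)) + (X - 1) ^ (2 * (n + 1)) : ℤ[X]) =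
      2 * ((X ^ 2 - 1) ^ (n + 1) + 2 * s) := by
  induction n using Nat.twoStepInduction with
  | zero => exact ⟨1, by simpa using sq_sub_one_pow_mem 0, by ring⟩
  | one =>
    refine ⟨4 + 4 * (X ^ 2 - 1),
      add_mem (by simpa using four_mul_mem (sq_sub_one_pow_mem 0)) ?_, by ring⟩
    simpa [zsmul_eq_mul] using Submodule.smul_mem _ (4 : ℤ) (sq_sub_one_pow_mem 1)
  | more n h0 h1 =>
    obtain ⟨s, hs, es⟩ := h0
    obtain ⟨t, ht, et⟩ := h1
    refine ⟨(2 : ℤ) • (X ^ 2 - 1) ^ (n + 2) + 4 * t + (2 : ℤ) • ((X ^ 2 - 1) * t)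
      - (X ^ 2 - 1) * ((X ^ 2 - 1) * s), ?_, ?_⟩
    · exact sub_mem (add_mem (add_mem (Submodule.smul_mem _ _ (sq_sub_one_pow_mem _))
        (four_mul_mem ht)) (Submodule.smul_mem _ _ (sq_sub_one_mul_mem ht)))
        (sq_sub_one_mul_mem (sq_sub_one_mul_mem hs))
    · have h : ((X + 1) ^ (2 * (n + 2 + 1)) + (X - 1) ^ (2 * (n + 2 + 1)) : ℤ[X]) =
          (4 + 2 * (X ^ 2 - 1)) * ((X + 1) ^ (2 * (n + 1 + 1)) + (X - 1) ^ (2 * (n + 1 + 1)))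
          - (X ^ 2 - 1) ^ 2 * ((X + 1) ^ (2 * (n + 1)) + (X - 1) ^ (2 * (n + 1))) := by
        ring
      rw [h, es, et]
      simp only [zsmul_eq_mul]
      push_cast
      ring

lemma apply_one : eulerFunctional 1 = 1 := by
  rw [← pow_zero X, apply_X_pow, eulerNumber]

lemma apply_sq_sub_one : eulerFunctional (X ^ 2 - 1) = -2 := by
  have h := apply_add_one_pow_add_sub_one_pow two_ne_zero
  rw [show ((X + 1) ^ 2 + (X - 1) ^ 2 : ℤ[X]) = (2 : ℤ) • (X ^ 2 - 1) + (4 : ℤ) • 1 by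
    simp only [zsmul_eq_mul]; push_cast; ring, map_add, map_zsmul, map_zsmul, apply_one,
    smul_eq_mul, smul_eq_mul] at h
  linarith

lemma apply_sq_sub_one_sq : eulerFunctional ((X ^ 2 - 1) ^ 2) = 8 := by
  have h := apply_add_one_pow_add_sub_one_pow four_ne_zero
  rw [show ((X + 1) ^ 4 + (X - 1) ^ 4 : ℤ[X]) =
      (2 : ℤ) • (X ^ 2 - 1) ^ 2 + (16 : ℤ) • (X ^ 2 - 1) + (16 : ℤ) • 1 by
    simp only [zsmul_eq_mul]; push_cast; ring, map_add, map_add, map_zsmul, map_zsmul,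
    map_zsmul, apply_one, apply_sq_sub_one, smul_eq_mul, smul_eq_mul, smul_eq_mul] at h
  linarith

lemma two_pow_dvd_apply_sq_sub_one_pow (i : ℕ) (hi : 2 ≤ i) :
    (2 ^ (i + 1) : ℤ) ∣ eulerFunctional ((X ^ 2 - 1) ^ i) := by
  induction i using Nat.strong_induction_on with
  | _ i ih =>
    rcases hi.eq_or_lt with rfl | hi
    · rw [apply_sq_sub_one_sq]
      norm_num
    obtain ⟨n, rfl⟩ : ∃ n, i = n + 1 := ⟨i - 1, by omega⟩
    obtain ⟨s, hs, es⟩ := exists_mem_homogeneousSpan n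
    have bound : (2 ^ (n + 1) : ℤ) ∣ eulerFunctional s := by
      clear es
      induction hs using Submodule.span_induction with
      | mem f h =>
        obtain ⟨a, b, rfl, rfl⟩ := h
        rw [apply_intCast_mul, show (4 : ℤ) = 2 ^ 2 by norm_num, ← pow_mul]
        rcases lt_or_ge b 2 with hb | hb
        · interval_cases b
          · exact (pow_dvd_pow 2 (by omega)).mul_right _
          · rw [pow_one, apply_sq_sub_one, mul_neg, dvd_neg, ← pow_succ]
            exact pow_dvd_pow 2 (by omega)
        · exact (pow_dvd_pow 2 (by omega)).trans
            ((pow_add (2 : ℤ) (2 * a) (b + 1)).dvd.trans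
              (mul_dvd_mul_left _ (ih b (by omega) hb)))
      | zero => simp
      | add f g _ _ hf hg => rw [map_add]; exact dvd_add hf hg
      | smul c f _ hf => rw [map_zsmul, smul_eq_mul]; exact hf.mul_left c
    have h := apply_add_one_pow_add_sub_one_pow (show 2 * (n + 1) ≠ 0 by omega)
    rw [es, show (2 * ((X ^ 2 - 1) ^ (n + 1) + 2 * s) : ℤ[X]) =
      (2 : ℤ) • (X ^ 2 - 1) ^ (n + 1) + (4 : ℤ) • s by
      simp only [zsmul_eq_mul]; push_cast; ring, map_add, map_zsmul, map_zsmul,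
      smul_eq_mul, smul_eq_mul] at h
    obtain ⟨c, hc⟩ := bound
    exact ⟨-c, by rw [hc] at h; rw [pow_succ (2 : ℤ) (n + 1)]; linarith⟩

end eulerFunctional

open Polynomial in
lemma eulerNumber_two_mul (m N : ℕ) (h : m ≤ N) :
    eulerNumber (2 * m) = ∑ i ∈ Finset.range (N + 1),
      (m.choose i : ℤ) * eulerFunctional ((X ^ 2 - 1) ^ i) := by
  have e : (X ^ (2 * m) : ℤ[X]) = ∑ i ∈ Finset.range (m + 1),
      (m.choose i : ℤ) • (X ^ 2 - 1) ^ i := by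
    rw [pow_mul, show (X ^ 2 : ℤ[X]) = (X ^ 2 - 1) + 1 by ring, add_pow]
    refine Finset.sum_congr rfl fun i _ => ?_
    rw [zsmul_eq_mul]
    simp [mul_comm]
  rw [← eulerFunctional.apply_X_pow, e, map_sum]
  simp only [map_zsmul, smul_eq_mul]
  refine Finset.sum_subset (Finset.range_subset_range.mpr (by omega)) fun i _ hi => ?_
  rw [Nat.choose_eq_zero_of_lt (by simpa using hi)]
  simp

lemma two_pow_dvd_two_pow_mul_choose {s h : ℕ} (hs : 2 ^ s ∣ h) (j : ℕ) :
    2 ^ s ∣ 2 ^ j * h.choose (j + 1) := by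
  obtain ⟨v, m, hm, e⟩ := Nat.exists_eq_two_pow_mul_odd (Nat.succ_ne_zero j)
  have hv : v ≤ j := by
    have h1 : 2 ^ v ≤ j + 1 := Nat.le_of_dvd (by omega) ⟨m, e⟩
    have h2 : v < 2 ^ v := Nat.lt_two_pow_self
    omega
  have hd : 2 ^ s ∣ (j + 1) * h.choose (j + 1) := by
    rcases h with _ | h
    · simp
    · rw [mul_comm, ← Nat.add_one_mul_choose_eq]
      exact hs.mul_right _
  replace hd : 2 ^ s ∣ m * (2 ^ v * h.choose (j + 1)) := by
    rwa [← mul_assoc, mul_comm m, ← e]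
  exact ((Nat.Coprime.pow_left s (Nat.coprime_two_left.mpr hm)).dvd_of_dvd_mul_left hd).trans
    (mul_dvd_mul_right (pow_dvd_pow 2 hv) _)

lemma two_pow_dvd_choose_add_sub_choose {s h : ℕ} (hs : 2 ^ s ∣ h) (l i : ℕ) :
    (2 ^ s : ℤ) ∣ 2 ^ i * (((l + h).choose (i + 1) : ℤ) - l.choose (i + 1)) := by
  rw [add_comm l h, Nat.add_choose_eq, Finset.Nat.sum_antidiagonal_eq_sum_range_succ_mk,
    Finset.sum_range_succ']
  simp only [Nat.choose_zero_right, one_mul, Nat.sub_zero, Nat.cast_add, add_sub_cancel_right]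
  exact_mod_cast Finset.mul_sum (Finset.range (i + 1)) _ (2 ^ i) ▸ Finset.dvd_sum fun j hj =>
    ((two_pow_dvd_two_pow_mul_choose hs j).trans (mul_dvd_mul_right
      (pow_dvd_pow 2 (Nat.lt_succ_iff.mp (Finset.mem_range.mp hj))) _)).trans
      (by rw [← mul_assoc]; exact dvd_mul_right _ _)

lemma two_pow_dvd_eulerNumber_sub {s h : ℕ} (hs : 2 ^ s ∣ h) (l : ℕ) :
    (2 ^ (s + 2) : ℤ) ∣ eulerNumber (2 * (l + h)) - eulerNumber (2 * l) + 2 * h := by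
  rw [eulerNumber_two_mul (l + h) (l + h + 1) (by omega),
    eulerNumber_two_mul l (l + h + 1) (by omega), ← Finset.sum_sub_distrib,
    Finset.sum_range_succ', Finset.sum_range_succ']
  simp only [pow_zero, zero_add, pow_one, eulerFunctional.apply_one,
    eulerFunctional.apply_sq_sub_one, Nat.choose_zero_right, Nat.choose_one_right]
  have key : (2 ^ (s + 2) : ℤ) ∣ ∑ i ∈ Finset.range (l + h),
      (((l + h).choose (i + 1 + 1) : ℤ) * eulerFunctional ((Polynomial.X ^ 2 - 1) ^ (i + 1 + 1)) -
        (l.choose (i + 1 + 1) : ℤ) *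
          eulerFunctional ((Polynomial.X ^ 2 - 1) ^ (i + 1 + 1))) := by
    refine Finset.dvd_sum fun i _ => ?_
    obtain ⟨c, hc⟩ := eulerFunctional.two_pow_dvd_apply_sq_sub_one_pow (i + 1 + 1) (by omega)
    obtain ⟨d, hd⟩ := two_pow_dvd_choose_add_sub_choose hs l (i + 1)
    refine ⟨d * c, ?_⟩
    rw [hc]
    linear_combination 4 * c * hd
  convert key using 1
  push_cast
  ring

lemma two_pow_dvd_eulerNumber_sub_iff (l h n : ℕ) :
    (2 ^ (n + 1) : ℤ) ∣ eulerNumber (2 * (l + h)) - eulerNumber (2 * l) ↔ 2 ^ n ∣ h := by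
  have cancel (m : ℕ) : (2 ^ (m + 1) : ℤ) ∣ 2 * h ↔ 2 ^ m ∣ h := by
    rw [pow_succ', mul_dvd_mul_iff_left two_ne_zero]
    exact_mod_cast Iff.rfl
  constructor
  · intro H
    induction n with
    | zero => simp
    | succ n ih =>
      have hn := ih ((pow_dvd_pow 2 (by omega)).trans H)
      exact (cancel _).mp ((dvd_add_right H).mp (two_pow_dvd_eulerNumber_sub hn l))
  · intro H
    exact (dvd_add_left ((cancel n).mpr H)).mp
      ((pow_dvd_pow 2 (by omega)).trans (two_pow_dvd_eulerNumber_sub H l))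

lemma eulerNumber_modEq_iff_of_le {k l n : ℕ} (hk : Even k) (hl : Even l) (hn : 0 < n)
    (hlk : l ≤ k) :
    eulerNumber l ≡ eulerNumber k [ZMOD 2 ^ n] ↔ l ≡ k [MOD 2 ^ n] := by
  obtain ⟨a, rfl⟩ := hl.two_dvd
  obtain ⟨b, rfl⟩ := hk.two_dvd
  obtain ⟨h, rfl⟩ : ∃ h, b = a + h := ⟨b - a, by omega⟩
  obtain ⟨m, rfl⟩ : ∃ m, n = m + 1 := ⟨n - 1, by omega⟩
  rw [Int.modEq_iff_dvd, two_pow_dvd_eulerNumber_sub_iff, Nat.modEq_iff_dvd' hlk, ← Nat.mul_sub,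
    Nat.add_sub_cancel_left, pow_succ', Nat.mul_dvd_mul_iff_left two_pos]

theorem stmt_2 (k l : ℕ) (hk : Even k) (hl : Even l) (n : ℕ) (hn : 0 < n) :
    eulerNumber k ≡ eulerNumber l [ZMOD 2 ^ n] ↔ k ≡ l [MOD 2 ^ n] := by
  rcases le_total k l with h | h
  · exact eulerNumber_modEq_iff_of_le hl hk hn h
  · rw [Int.modEq_comm, Nat.ModEq.comm]
    exact eulerNumber_modEq_iff_of_le hk hl hn h
end

section
/- Let a be an integer, let k be a nonnegative integer, let m be a positive integer, and let q be a positive even integer with gcd(m, q) = 1 (so m is odd). Then the polynomial (m^(k+1)/2) * E_k((x+a)/m) - ((-1)^a/2) * E_k(x) - ∑_{j=0}^{q-1} (-1)^(j-1) * (⌊(a+jm)/q⌋ + (1-m)/2) * (x+a+jm)^k, as an element of ℚ[x], equals q times a polynomial in ℚ[x] each of whose coefficients is a rational number with denominator coprime to q. -/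
open Polynomial

theorem derivative_eulerPoly_succ (n : ℕ) :
    derivative (eulerPoly (n + 1)) = C ((n : ℚ) + 1) * eulerPoly n := by
  unfold eulerPoly
  rw [Finset.sum_range_succ, derivative_add, derivative_sum, Finset.mul_sum]
  simp only [Nat.sub_self, pow_zero, mul_one, derivative_C, add_zero]
  refine Finset.sum_congr rfl fun k hk => ?_
  have hk' : k ≤ n := Nat.lt_succ_iff.mp (Finset.mem_range.mp hk)
  obtain ⟨d, rfl⟩ := Nat.exists_eq_add_of_le hk'
  have h1 : k + d + 1 - k = d + 1 := by omega
  have h2 : k + d - k = d := by omega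
  have h3 : ((k + d + 1).choose k : ℚ) * (d + 1) = (k + d + 1) * ((k + d).choose k : ℚ) := by
    have := Nat.add_one_mul_choose_eq (k + d) d
    rw [show (k + d + 1).choose (d + 1) = (k + d + 1).choose k from
      Nat.choose_symm_of_eq_add (by omega),
      show (k + d).choose d = (k + d).choose k from Nat.choose_symm_of_eq_add (by omega)] at this
    exact_mod_cast this.symm
  rw [h1, h2, derivative_C_mul, derivative_X_sub_C_pow, ← mul_assoc, ← mul_assoc]
  simp only [Nat.add_sub_cancel]
  rw [← C_mul, ← C_mul]
  congr 2
  push_cast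
  linear_combination ((eulerNumber k : ℚ) / 2 ^ k) * h3

theorem eulerNumber_succ (n : ℕ) :
    eulerNumber (n + 1) = -∑ k ∈ Finset.range (n + 1),
      if Even (n + 1 - k) then ((n + 1).choose k : ℤ) * eulerNumber k else 0 := by
  rw [eulerNumber, ← Finset.sum_attach (Finset.range (n + 1))]

theorem eulerPoly_zero : eulerPoly 0 = 1 := by
  simp [eulerPoly, eulerNumber]

theorem eulerPoly_succ_eval_one_add_eval_zero (n : ℕ) :
    (eulerPoly (n + 1)).eval 1 + (eulerPoly (n + 1)).eval 0 = 0 := by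
  have key : (eulerPoly (n + 1)).eval 1 + (eulerPoly (n + 1)).eval 0 =
      2 / 2 ^ (n + 1) * ((∑ k ∈ Finset.range (n + 1 + 1),
        if Even (n + 1 - k) then ((n + 1).choose k : ℤ) * eulerNumber k else 0 : ℤ) : ℚ) := by
    unfold eulerPoly
    rw [eval_finsetSum, eval_finsetSum, ← Finset.sum_add_distrib, Int.cast_sum, Finset.mul_sum]
    refine Finset.sum_congr rfl fun k hk => ?_
    obtain ⟨d, hd⟩ := Nat.exists_eq_add_of_le (Nat.lt_succ_iff.mp (Finset.mem_range.mp hk))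
    have h2 : n + 1 - k = d := by omega
    rw [h2]
    simp only [eval_mul, eval_C, eval_pow, eval_sub, eval_X]
    rw [show (1 : ℚ) - 1 / 2 = 1 / 2 by norm_num, show (0 : ℚ) - 1 / 2 = -(1 / 2) by norm_num]
    rcases Nat.even_or_odd d with h | h
    · rw [if_pos h, h.neg_pow, hd]
      push_cast
      rw [pow_add, div_pow, one_pow]
      field_simp
      ring
    · rw [if_neg (Nat.not_even_iff_odd.mpr h), h.neg_pow]
      push_cast
      ring
  rw [key, Finset.sum_range_succ, eulerNumber_succ]
  simp

theorem eulerPoly_comp_X_add_one (n : ℕ) :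
    (eulerPoly n).comp (X + 1) + eulerPoly n = 2 * X ^ n := by
  induction n with
  | zero => simp [eulerPoly_zero]; norm_num
  | succ n ih =>
    have hd : derivative ((eulerPoly (n + 1)).comp (X + 1) + eulerPoly (n + 1)
        - 2 * X ^ (n + 1)) = 0 := by
      have h2 : derivative (2 * X ^ (n + 1) : ℚ[X]) = C ((n : ℚ) + 1) * (2 * X ^ n) := by
        rw [show (2 : ℚ[X]) = C 2 from rfl, derivative_C_mul, derivative_X_pow]
        simp
        ring
      rw [derivative_sub, derivative_add, derivative_comp, derivative_eulerPoly_succ, h2, ← ih]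
      simp
      ring
    have hc := eq_C_of_derivative_eq_zero hd
    have h0 : ((eulerPoly (n + 1)).comp (X + 1) + eulerPoly (n + 1)
        - 2 * X ^ (n + 1)).coeff 0 = 0 := by
      rw [coeff_zero_eq_eval_zero]
      have := eulerPoly_succ_eval_one_add_eval_zero n
      simpa [eval_comp] using this
    rw [h0, C_0] at hc
    exact sub_eq_zero.mp hc

/-- The sequence `m ^ n * E_n((x + a) / m)`. -/
noncomputable def scaledEulerPoly (m : ℕ) (a : ℤ) (n : ℕ) : ℚ[X] :=
  C ((m : ℚ) ^ n) * (eulerPoly n).comp (C (1 / (m : ℚ)) * (X + C (a : ℚ)))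

theorem scaledEulerPoly_comp {m : ℕ} (hm : 0 < m) (a : ℤ) (n : ℕ) :
    (scaledEulerPoly m a n).comp (X + (m : ℚ[X])) + scaledEulerPoly m a n =
      2 * (X + (a : ℚ[X])) ^ n := by
  have hm' : (m : ℚ) ≠ 0 := by positivity
  have h1 : C (1 / (m : ℚ)) * (m : ℚ[X]) = 1 := by
    rw [← C_eq_natCast, ← C_mul, one_div_mul_cancel hm', C_1]
  have h := congrArg (fun p => p.comp (C (1 / (m : ℚ)) * (X + C (a : ℚ))))
    (eulerPoly_comp_X_add_one n)
  simp only [add_comp, mul_comp, comp_assoc, pow_comp, X_comp, one_comp, ofNat_comp, Nat.cast_ofNat] at h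
  unfold scaledEulerPoly
  rw [mul_comp, C_comp, comp_assoc]
  have h2 : (C (1 / (m : ℚ)) * (X + C (a : ℚ))).comp (X + (m : ℚ[X])) =
      C (1 / (m : ℚ)) * (X + C (a : ℚ)) + 1 := by
    rw [mul_comp, C_comp, add_comp, X_comp, C_comp, ← h1]
    ring
  rw [h2, ← mul_add, h, C_pow, C_eq_natCast, mul_pow, ← C_eq_intCast]
  rw [show (m : ℚ[X]) ^ n * (2 * (C (1 / (m : ℚ)) ^ n * (X + C (a : ℚ)) ^ n)) =
    2 * ((C (1 / (m : ℚ)) * (m : ℚ[X])) ^ n * (X + C (a : ℚ)) ^ n) by ring, h1, one_pow, one_mul]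

theorem derivative_scaledEulerPoly_succ {m : ℕ} (hm : 0 < m) (a : ℤ) (n : ℕ) :
    derivative (scaledEulerPoly m a (n + 1)) = ((n : ℚ[X]) + 1) * scaledEulerPoly m a n := by
  have hm' : (m : ℚ) ≠ 0 := by positivity
  have h1 : C (1 / (m : ℚ)) * C (m : ℚ) = 1 := by
    rw [← C_mul, one_div_mul_cancel hm', C_1]
  unfold scaledEulerPoly
  rw [derivative_C_mul, derivative_comp, derivative_eulerPoly_succ, derivative_C_mul, mul_comp,
    C_comp, pow_succ, C_mul]
  simp only [derivative_add, derivative_X, derivative_C, add_zero, mul_one, C_add, C_1,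
    C_eq_natCast] at h1 ⊢
  linear_combination ((C ((m : ℚ) ^ n)) * ((n : ℚ[X]) + 1) *
    (eulerPoly n).comp (C (1 / (m : ℚ)) * (X + C (a : ℚ)))) * h1

theorem scaledEulerPoly_one_zero (n : ℕ) : scaledEulerPoly 1 0 n = eulerPoly n := by
  simp [scaledEulerPoly]

theorem sum_neg_one_pow_mul_pow {m : ℕ} (hm : 0 < m) (a : ℤ) (n Q : ℕ) :
    2 * ∑ j ∈ Finset.range Q, (-1) ^ j * (X + ((a + j * m : ℤ) : ℚ[X])) ^ n =
      scaledEulerPoly m a n -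
        (-1) ^ Q * (scaledEulerPoly m a n).comp (X + ((Q * m : ℤ) : ℚ[X])) := by
  induction Q with
  | zero => simp
  | succ Q ih =>
    have h := congrArg (fun p => p.comp (X + ((Q * m : ℤ) : ℚ[X])))
      (scaledEulerPoly_comp hm a n)
    simp only [add_comp, mul_comp, comp_assoc, pow_comp, X_comp, natCast_comp,
      intCast_comp, ofNat_comp, Nat.cast_ofNat] at h
    have e1 : X + ((Q * m : ℤ) : ℚ[X]) + (m : ℚ[X]) = X + (((Q + 1 : ℕ) * m : ℤ) : ℚ[X]) := by
      push_cast; ring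
    have e2 : X + ((Q * m : ℤ) : ℚ[X]) + (a : ℚ[X]) = X + ((a + Q * m : ℤ) : ℚ[X]) := by
      push_cast; ring
    rw [e1, e2] at h
    rw [Finset.sum_range_succ, mul_add, ih, pow_succ]
    linear_combination (-(-1 : ℚ[X]) ^ Q) * h

/-- The subring of rationals whose denominator is coprime to `q`. -/
def ratIntegers (q : ℕ) : Subring ℚ where
  carrier := {r | Nat.Coprime r.den q}
  mul_mem' {a b} ha hb :=
    Nat.Coprime.coprime_dvd_left (Rat.mul_den_dvd a b) (Nat.Coprime.mul_left ha hb)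
  add_mem' {a b} ha hb :=
    Nat.Coprime.coprime_dvd_left (Rat.add_den_dvd a b) (Nat.Coprime.mul_left ha hb)
  one_mem' := by simp
  zero_mem' := by simp
  neg_mem' {a} ha := by simpa using ha

theorem mem_ratIntegers_iff {q : ℕ} {r : ℚ} : r ∈ ratIntegers q ↔ Nat.Coprime r.den q := Iff.rfl

theorem intCast_div_natCast_mem_ratIntegers {q c : ℕ} (b : ℤ) (hc : Nat.Coprime c q) :
    (b : ℚ) / c ∈ ratIntegers q := by
  refine Nat.Coprime.coprime_dvd_left ?_ hc
  have := Rat.den_dvd b c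
  rw [Rat.divInt_eq_div] at this
  exact_mod_cast this

theorem exists_pow_mul_of_pos (q : ℕ) {D : ℕ} (hD : 0 < D) :
    ∃ t c e : ℕ, Nat.Coprime c q ∧ q ^ t * c = D * e := by
  induction D using induction_on_primes with
  | zero => exact absurd hD (lt_irrefl _)
  | one => exact ⟨0, 1, 1, by simp, by simp⟩
  | prime_mul p D hp ih =>
    obtain ⟨t, c, e, hc, h⟩ := ih (Nat.pos_of_mul_pos_left hD)
    by_cases hpq : p ∣ q
    · obtain ⟨r, hr⟩ := hpq
      refine ⟨t + 1, c, e * r, hc, ?_⟩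
      calc q ^ (t + 1) * c = q * (q ^ t * c) := by ring
        _ = p * r * (D * e) := by rw [h, ← hr]
        _ = _ := by ring
    · refine ⟨t, c * p, e, Nat.Coprime.mul_left hc ((Nat.Prime.coprime_iff_not_dvd hp).mpr hpq), ?_⟩
      rw [← mul_assoc, h]; ring

section Remainders

variable {A : Type*} [CommRing A] (S : Subring A)

theorem Subring.exists_add_pow_eq {u h : A} (hu : u ∈ S) (hh : h ∈ S) (k : ℕ) :
    ∃ w ∈ S, (u + h) ^ k = u ^ k + h * w := by
  induction k with
  | zero => exact ⟨0, S.zero_mem, by simp⟩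
  | succ k ih =>
    obtain ⟨w, hw, e⟩ := ih
    refine ⟨u ^ k + w * (u + h), S.add_mem (S.pow_mem hu k) (S.mul_mem hw (S.add_mem hu hh)), ?_⟩
    rw [pow_succ, e]; ring

theorem Subring.exists_add_pow_succ_eq {u h : A} (hu : u ∈ S) (hh : h ∈ S) (k : ℕ) :
    ∃ w ∈ S, (u + h) ^ (k + 1) = u ^ (k + 1) + (k + 1) * h * u ^ k + h ^ 2 * w := by
  induction k with
  | zero => exact ⟨0, S.zero_mem, by simp⟩
  | succ k ih =>
    obtain ⟨w, hw, e⟩ := ih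
    refine ⟨(k + 1) * u ^ k + w * (u + h), S.add_mem (S.mul_mem (S.add_mem (natCast_mem S k)
      S.one_mem) (S.pow_mem hu k)) (S.mul_mem hw (S.add_mem hu hh)), ?_⟩
    rw [pow_succ, e]; push_cast; ring

end Remainders

section Taylor

variable {S : Subring ℚ[X]}

theorem exists_natCast_mul_mem (hX : X ∈ S) (p : ℚ[X]) : ∃ D : ℕ, 0 < D ∧ (D : ℚ[X]) * p ∈ S := by
  induction p using Polynomial.induction_on' with
  | add p r hp hr =>
    obtain ⟨D, hD, h⟩ := hp
    obtain ⟨E, hE, h'⟩ := hr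
    refine ⟨D * E, Nat.mul_pos hD hE, ?_⟩
    have : ((D * E : ℕ) : ℚ[X]) * (p + r) = E * (D * p) + D * (E * r) := by push_cast; ring
    rw [this]
    exact S.add_mem (S.mul_mem (natCast_mem S E) h) (S.mul_mem (natCast_mem S D) h')
  | monomial n a =>
    refine ⟨a.den, a.den_pos, ?_⟩
    have : (a.den : ℚ[X]) * monomial n a = (a.num : ℚ[X]) * X ^ n := by
      rw [← C_mul_X_pow_eq_monomial, ← mul_assoc, ← C_eq_natCast, ← C_mul, mul_comm,
        Rat.mul_comm, Rat.mul_den_eq_num, C_eq_intCast, mul_comm]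
    rw [this]
    exact S.mul_mem (intCast_mem S _) (S.pow_mem hX n)

theorem exists_comp_X_add_eq (hX : X ∈ S) (p : ℚ[X]) :
    ∃ D : ℕ, 0 < D ∧ ∀ h ∈ S, ∃ w ∈ S,
      (D : ℚ[X]) * p.comp (X + h) = D * p + D * h * derivative p + h ^ 2 * w := by
  induction p using Polynomial.induction_on' with
  | add p r hp hr =>
    obtain ⟨D, hD, H⟩ := hp
    obtain ⟨E, hE, H'⟩ := hr
    refine ⟨D * E, Nat.mul_pos hD hE, fun h hh => ?_⟩
    obtain ⟨w, hw, e⟩ := H h hh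
    obtain ⟨w', hw', e'⟩ := H' h hh
    refine ⟨E * w + D * w', S.add_mem (S.mul_mem (natCast_mem S E) hw)
      (S.mul_mem (natCast_mem S D) hw'), ?_⟩
    rw [add_comp, derivative_add]
    push_cast
    linear_combination (E : ℚ[X]) * e + (D : ℚ[X]) * e'
  | monomial n a =>
    refine ⟨a.den, a.den_pos, fun h hh => ?_⟩
    have ha : (a.den : ℚ[X]) * C a = (a.num : ℚ[X]) := by
      rw [← C_eq_natCast, ← C_mul, mul_comm, Rat.mul_den_eq_num, C_eq_intCast]
    rw [← C_mul_X_pow_eq_monomial, mul_comp, C_comp, X_pow_comp, derivative_C_mul]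
    cases n with
    | zero => exact ⟨0, S.zero_mem, by simp⟩
    | succ n =>
      obtain ⟨w, hw, e⟩ := S.exists_add_pow_succ_eq hX hh n
      refine ⟨a.num * w, S.mul_mem (intCast_mem S _) hw, ?_⟩
      rw [derivative_X_pow, e, ← ha]
      simp
      ring

end Taylor

theorem sum_range_emod {M : Type*} [AddCommMonoid M] {m Q : ℕ} (hQ : 0 < Q)
    (h : Nat.Coprime m Q) (a : ℤ) (g : ℕ → M) :
    ∑ j ∈ Finset.range Q, g ((a + j * m) % Q).toNat = ∑ r ∈ Finset.range Q, g r := by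
  have hQ' : (0 : ℤ) < Q := by exact_mod_cast hQ
  have hinj : Set.InjOn (fun j : ℕ => ((a + j * m) % Q).toNat) (Finset.range Q) := by
    intro i hi j hj hij
    simp only [Finset.coe_range, Set.mem_Iio] at hi hj hij
    have h1 := Int.emod_nonneg (a + i * m) hQ'.ne'
    have h2 := Int.emod_nonneg (a + j * m) hQ'.ne'
    have h3 : (a + i * m) % Q = (a + j * m) % Q := by omega
    have h4 : (Q : ℤ) ∣ (m : ℤ) * ((j : ℤ) - i) := by
      have h5 := Int.ModEq.dvd h3
      rwa [show a + j * m - (a + i * m) = (m : ℤ) * ((j : ℤ) - i) by ring] at h5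
    have h5 : (Q : ℤ) ∣ (j : ℤ) - i :=
      IsCoprime.dvd_of_dvd_mul_left (Nat.isCoprime_iff_coprime.mpr h.symm) h4
    have h6 := Int.eq_zero_of_abs_lt_dvd h5 (by rw [abs_lt]; omega)
    omega
  have himg : (Finset.range Q).image (fun j : ℕ => ((a + j * m) % Q).toNat) = Finset.range Q := by
    refine Finset.eq_of_subset_of_card_le ?_ ?_
    · intro r hr
      obtain ⟨j, -, rfl⟩ := Finset.mem_image.mp hr
      have h1 := Int.emod_nonneg (a + j * m) hQ'.ne'
      have h2 := Int.emod_lt_of_pos (a + j * m) hQ'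
      rw [Finset.mem_range]
      omega
    · rw [Finset.card_image_of_injOn hinj]
  conv_rhs => rw [← himg]
  rw [Finset.sum_image hinj]

theorem sum_range_ediv {m N : ℕ} (hN : 0 < N) (h : Nat.Coprime m N) (f : ℤ) :
    2 * ∑ s ∈ Finset.range N, (f + s * m) / (N : ℤ) = 2 * f + (m - 1) * (N - 1) := by
  have hN' : (0 : ℤ) < N := by exact_mod_cast hN
  have hg : 2 * ∑ s ∈ Finset.range N, (s : ℤ) = N * (N - 1) := by
    clear h hN hN'
    induction N with
    | zero => simp
    | succ N ih => rw [Finset.sum_range_succ, mul_add, ih]; push_cast; ring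
  have hr := sum_range_emod hN h f (fun r => (r : ℤ))
  have h1 : ∀ s ∈ Finset.range N, (((f + s * m) % (N : ℤ)).toNat : ℤ) =
      f + s * m - N * ((f + s * m) / (N : ℤ)) := fun s _ => by
    rw [Int.toNat_of_nonneg (Int.emod_nonneg _ hN'.ne'), Int.emod_def]
  rw [Finset.sum_congr rfl h1, Finset.sum_sub_distrib, Finset.sum_add_distrib, ← Finset.mul_sum,
    ← Finset.sum_mul] at hr
  simp only [Finset.sum_const, Finset.card_range, nsmul_eq_mul] at hr
  refine mul_left_cancel₀ hN'.ne' ?_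
  linear_combination (-2) * hr + ((m : ℤ) - 1) * hg

theorem neg_one_pow_natAbs_mul {A : Type*} [CommRing A] {m Q : ℕ} (hQ : 0 < Q) (hm : Odd m)
    (hQ2 : Even Q) (a : ℤ) (j : ℕ) :
    (-1 : A) ^ j = (-1) ^ a.natAbs * (-1) ^ ((a + j * m) % Q).toNat := by
  rw [← pow_add, neg_one_pow_eq_pow_mod_two, neg_one_pow_eq_pow_mod_two (n := a.natAbs + _)]
  congr 1
  obtain ⟨l, rfl⟩ := hm
  obtain ⟨c, rfl⟩ := hQ2
  have h1 := Int.emod_nonneg (a + j * (2 * l + 1 : ℕ)) (b := ((c + c : ℕ) : ℤ)) (by omega)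
  have h2 := Int.emod_def (a + j * (2 * l + 1 : ℕ)) ((c + c : ℕ) : ℤ)
  set r := (a + j * (2 * l + 1 : ℕ)) % ((c + c : ℕ) : ℤ)
  set f := (a + j * (2 * l + 1 : ℕ)) / ((c + c : ℕ) : ℤ)
  have h3 : r = a + j + 2 * (j * l - c * f) := by rw [h2]; push_cast; ring
  generalize (j * l - c * f : ℤ) = v at h3
  omega

/-- The sum `∑_{j < q} (-1)^(j-1) (⌊(a + j m) / q⌋ + (1 - m) / 2) (x + a + j m)^k`
for `m = 2 * l + 1`. -/
noncomputable def floorSum (a : ℤ) (k l q : ℕ) : ℚ[X] :=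
  ∑ j ∈ Finset.range q, (-1) ^ (j + 1) *
    (((a + j * (2 * l + 1 : ℕ)) / (q : ℤ) - l : ℤ) : ℚ[X]) *
      (X + ((a + j * (2 * l + 1 : ℕ) : ℤ) : ℚ[X])) ^ k

theorem sum_range_mul_eq_sum_sum {M : Type*} [AddCommMonoid M] (f : ℕ → M) (q N : ℕ) :
    ∑ j ∈ Finset.range (q * N), f j =
      ∑ i ∈ Finset.range q, ∑ s ∈ Finset.range N, f (q * s + i) := by
  rw [Finset.sum_comm]
  induction N with
  | zero => simp
  | succ N ih => rw [Nat.mul_succ, Finset.sum_range_add, ih, Finset.sum_range_succ]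

theorem exists_floorSum_summand_eq {S : Subring ℚ[X]} (hX : X ∈ S) (a : ℤ) (k l m : ℕ) {q N : ℕ}
    (hq : 0 < q) (hq2 : Even q) (i s : ℕ) : ∃ w ∈ S, (-1) ^ (q * s + i + 1) *
      (((a + (q * s + i : ℕ) * m) / ((q * N : ℕ) : ℤ) - l : ℤ) : ℚ[X]) *
      (X + ((a + (q * s + i : ℕ) * m : ℤ) : ℚ[X])) ^ k =
      (-1) ^ (i + 1) * ((((a + i * m) / (q : ℤ) + s * m) / (N : ℤ) - l : ℤ) : ℚ[X]) *
      (X + ((a + i * m : ℤ) : ℚ[X])) ^ k + (q : ℚ[X]) * w := by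
  have hdiv : (a + (q * s + i : ℕ) * m) / ((q * N : ℕ) : ℤ) =
      ((a + i * m) / (q : ℤ) + s * m) / (N : ℤ) := by
    rw [Nat.cast_mul, ← Int.ediv_ediv_of_nonneg (by positivity)]
    congr 1
    rw [← Int.add_mul_ediv_right _ _ (by positivity)]
    congr 1
    push_cast
    ring
  have hsgn : (-1 : ℚ[X]) ^ (q * s + i + 1) = (-1) ^ (i + 1) := by
    rw [add_assoc, pow_add, (hq2.mul_right s).neg_one_pow, one_mul]
  obtain ⟨w, hw, e⟩ := S.exists_add_pow_eq (u := X + ((a + i * m : ℤ) : ℚ[X]))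
    (h := (q : ℚ[X]) * ((s * m : ℕ) : ℚ[X])) (S.add_mem hX (intCast_mem S _))
    (S.mul_mem (natCast_mem S _) (natCast_mem S _)) k
  have hpow : X + ((a + (q * s + i : ℕ) * m : ℤ) : ℚ[X]) =
      X + ((a + i * m : ℤ) : ℚ[X]) + (q : ℚ[X]) * ((s * m : ℕ) : ℚ[X]) := by
    push_cast; ring
  rw [hdiv, hsgn, hpow, e]
  refine ⟨(-1) ^ (i + 1) * ((((a + i * m) / (q : ℤ) + s * m) / (N : ℤ) - l : ℤ) : ℚ[X]) *
    (((s * m : ℕ) : ℚ[X]) * w), ?_, by ring⟩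
  exact S.mul_mem (S.mul_mem (S.pow_mem (S.neg_mem S.one_mem) _) (intCast_mem S _))
    (S.mul_mem (natCast_mem S _) hw)

theorem exists_floorSum_mul_eq {S : Subring ℚ[X]} (hX : X ∈ S) (a : ℤ) (k l : ℕ) {q N : ℕ}
    (hq : 0 < q) (hq2 : Even q) (hN : 0 < N) (hcop : Nat.Coprime (2 * l + 1) N) :
    ∃ w ∈ S, floorSum a k l (q * N) = floorSum a k l q + (q : ℚ[X]) * w := by
  choose w hw e using fun i s : ℕ =>
    exists_floorSum_summand_eq hX a k l (2 * l + 1) (N := N) hq hq2 i s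
  refine ⟨∑ i ∈ Finset.range q, ∑ s ∈ Finset.range N, w i s,
    S.sum_mem fun i _ => S.sum_mem fun s _ => hw i s, ?_⟩
  unfold floorSum
  rw [sum_range_mul_eq_sum_sum, Finset.mul_sum, ← Finset.sum_add_distrib]
  refine Finset.sum_congr rfl fun i _ => ?_
  rw [Finset.sum_congr rfl fun s _ => e i s, Finset.sum_add_distrib, ← Finset.mul_sum,
    ← Finset.sum_mul, ← Finset.mul_sum, ← Int.cast_sum]
  have h := sum_range_ediv hN hcop ((a + i * (2 * l + 1 : ℕ)) / (q : ℤ))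
  have h' : ∑ s ∈ Finset.range N, (((a + i * (2 * l + 1 : ℕ)) / (q : ℤ) +
      s * (2 * l + 1 : ℕ)) / (N : ℤ) - l) = (a + i * (2 * l + 1 : ℕ)) / (q : ℤ) - (l : ℤ) := by
    rw [Finset.sum_sub_distrib, Finset.sum_const, Finset.card_range, nsmul_eq_mul]
    refine mul_left_cancel₀ (two_ne_zero (α := ℤ)) ?_
    rw [mul_sub, h]
    push_cast
    ring
  rw [h']

theorem exists_natCast_mul_sub_floorSum_eq {S : Subring ℚ[X]} (hX : X ∈ S) (a : ℤ) (k l : ℕ) :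
    ∃ D : ℕ, 0 < D ∧ ∀ Q : ℕ, 0 < Q → Even Q → Nat.Coprime (2 * l + 1) Q → ∃ w ∈ S,
      (D : ℚ[X]) * (((2 * l + 1 : ℕ) : ℚ[X]) * scaledEulerPoly (2 * l + 1) a k -
        (-1) ^ a.natAbs * eulerPoly k - 2 * floorSum a k l Q) = 2 * (Q : ℚ[X]) * w := by
  set m := 2 * l + 1 with hm
  have hm0 : 0 < m := by omega
  obtain ⟨D₁, hD₁, H₁⟩ := exists_comp_X_add_eq hX (scaledEulerPoly m a (k + 1))
  obtain ⟨D₂, hD₂, H₂⟩ := exists_comp_X_add_eq hX (eulerPoly (k + 1))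
  obtain ⟨D₃, hD₃, H₃⟩ := exists_comp_X_add_eq hX (scaledEulerPoly m a k)
  obtain ⟨D₄, hD₄, H₄⟩ := exists_natCast_mul_mem hX (derivative (scaledEulerPoly m a k))
  refine ⟨2 * (k + 1) * (D₁ * D₂ * (D₃ * D₄)), by positivity, fun Q hQ hQ2 hcop => ?_⟩
  obtain ⟨w₁, hw₁, e₁⟩ := H₁ ((Q * m : ℤ) : ℚ[X]) (intCast_mem S _)
  obtain ⟨w₂, hw₂, e₂⟩ := H₂ ((Q : ℤ) : ℚ[X]) (intCast_mem S _)
  obtain ⟨w₃, hw₃, e₃⟩ := H₃ ((Q * m : ℤ) : ℚ[X]) (intCast_mem S _)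
  rw [derivative_scaledEulerPoly_succ hm0] at e₁
  have hd := derivative_scaledEulerPoly_succ (m := 1) one_pos 0 k
  rw [scaledEulerPoly_one_zero, scaledEulerPoly_one_zero] at hd
  rw [hd] at e₂
  have s₁ := sum_neg_one_pow_mul_pow hm0 a (k + 1) Q
  have s₂ := sum_neg_one_pow_mul_pow (m := 1) one_pos 0 (k + 1) Q
  have s₃ := sum_neg_one_pow_mul_pow hm0 a k Q
  rw [scaledEulerPoly_one_zero] at s₂
  rw [hQ2.neg_one_pow, one_mul] at s₁ s₂ s₃
  have hterm : ∀ j : ℕ, ∃ w ∈ S, ((k : ℚ[X]) + 1) * (Q : ℚ[X]) *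
      ((-1) ^ j * (((a + j * m) / (Q : ℤ) : ℤ) : ℚ[X]) *
        (X + ((a + j * m : ℤ) : ℚ[X])) ^ k) =
      (-1) ^ j * (X + ((a + j * m : ℤ) : ℚ[X])) ^ (k + 1) -
      (-1) ^ a.natAbs * ((-1) ^ ((a + j * m) % Q).toNat *
        (X + ((0 + ((a + j * m) % Q).toNat * (1 : ℕ) : ℤ) : ℚ[X])) ^ (k + 1)) + (Q : ℚ[X]) ^ 2 * w := by
    intro j
    obtain ⟨w, hw, e⟩ := S.exists_add_pow_succ_eq (u := X + ((a + j * m : ℤ) : ℚ[X]))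
      (h := -((Q : ℚ[X]) * (((a + j * m) / (Q : ℤ) : ℤ) : ℚ[X]))) (S.add_mem hX (intCast_mem S _))
      (S.neg_mem (S.mul_mem (natCast_mem S _) (intCast_mem S _))) k
    refine ⟨(-1) ^ j * ((((a + j * m) / (Q : ℤ) : ℤ) : ℚ[X]) ^ 2 * w), S.mul_mem
      (S.pow_mem (S.neg_mem S.one_mem) _) (S.mul_mem (S.pow_mem (intCast_mem S _) _) hw), ?_⟩
    have hr : X + ((a + j * m : ℤ) : ℚ[X]) + -((Q : ℚ[X]) * (((a + j * m) / (Q : ℤ) : ℤ) : ℚ[X])) =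
        X + ((0 + ((a + j * m) % Q).toNat * (1 : ℕ) : ℤ) : ℚ[X]) := by
      rw [Int.toNat_of_nonneg (Int.emod_nonneg _ (by exact_mod_cast hQ.ne')), Int.emod_def]
      push_cast
      ring
    rw [hr] at e
    rw [← mul_assoc ((-1) ^ a.natAbs), ← neg_one_pow_natAbs_mul hQ ⟨l, hm⟩ hQ2 a j, e]
    ring
  choose w hw e using hterm
  have hsum := Finset.sum_congr (rfl : Finset.range Q = Finset.range Q) fun j _ => e j
  rw [← Finset.mul_sum, Finset.sum_add_distrib, Finset.sum_sub_distrib, ← Finset.mul_sum,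
    ← Finset.mul_sum, sum_range_emod hQ hcop a (fun r => (-1 : ℚ[X]) ^ r *
      (X + ((0 + r * (1 : ℕ) : ℤ) : ℚ[X])) ^ (k + 1))] at hsum
  have hT : floorSum a k l Q = l * ∑ j ∈ Finset.range Q, (-1) ^ j *
      (X + ((a + j * m : ℤ) : ℚ[X])) ^ k - ∑ j ∈ Finset.range Q,
      (-1) ^ j * (((a + j * m) / (Q : ℤ) : ℤ) : ℚ[X]) * (X + ((a + j * m : ℤ) : ℚ[X])) ^ k := by
    unfold floorSum
    rw [Finset.mul_sum, ← Finset.sum_sub_distrib]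
    refine Finset.sum_congr rfl fun j _ => ?_
    rw [Int.cast_sub, pow_succ, Int.cast_natCast]
    ring
  rw [hT]
  generalize ∑ j ∈ Finset.range Q, (-1 : ℚ[X]) ^ j * (((a + j * m) / (Q : ℤ) : ℤ) : ℚ[X]) *
    (X + ((a + j * m : ℤ) : ℚ[X])) ^ k = F at hsum ⊢
  set W := ∑ j ∈ Finset.range Q, w j with hW
  have hWS : W ∈ S := S.sum_mem fun j _ => hw j
  have hQ0 : (Q : ℚ[X]) ≠ 0 := by exact_mod_cast hQ.ne'
  refine ⟨-((D₂ * D₃ * D₄ * m ^ 2 : ℕ) * w₁) + (D₁ * D₃ * D₄ : ℕ) * ((-1) ^ a.natAbs * w₂)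
    + (2 * D₁ * D₂ * D₃ * D₄ : ℕ) * W + (D₁ * D₂ * D₃ * l * (k + 1) * m : ℕ) *
      (D₄ * derivative (scaledEulerPoly m a k)) +
      (D₁ * D₂ * D₄ * l * (k + 1) * Q * m ^ 2 : ℕ) * w₃, ?_, ?_⟩
  · exact S.add_mem (S.add_mem (S.add_mem (S.add_mem
      (S.neg_mem (S.mul_mem (natCast_mem S _) hw₁))
      (S.mul_mem (natCast_mem S _) (S.mul_mem (S.pow_mem (S.neg_mem S.one_mem) _) hw₂)))
      (S.mul_mem (natCast_mem S _) hWS)) (S.mul_mem (natCast_mem S _) H₄))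
      (S.mul_mem (natCast_mem S _) hw₃)
  · refine mul_left_cancel₀ hQ0 ?_
    push_cast at hsum s₁ s₂ s₃ e₁ e₂ e₃ ⊢
    simp only [mul_one] at s₂ e₂ hsum
    linear_combination (4 * (D₁ * D₂ * (D₃ * D₄)) : ℚ[X]) * hsum +
      (2 * (D₁ * D₂ * (D₃ * D₄)) : ℚ[X]) * s₁ - (2 * (D₂ * D₃ * D₄) : ℚ[X]) * e₁ -
      (2 * (D₁ * D₂ * (D₃ * D₄)) * (-1) ^ a.natAbs : ℚ[X]) * s₂ +
      (2 * (D₁ * D₃ * D₄) * (-1) ^ a.natAbs : ℚ[X]) * e₂ -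
      (2 * (k + 1) * Q * l * (D₁ * D₂ * (D₃ * D₄)) : ℚ[X]) * s₃ +
      (2 * (k + 1) * Q * l * (D₁ * D₂ * D₄) : ℚ[X]) * e₃

theorem exists_sub_floorSum_eq {q : ℕ} {S : Subring ℚ[X]} (hX : X ∈ S)
    (hS : ∀ r ∈ ratIntegers q, C r ∈ S) (a : ℤ) (k l : ℕ) (hq : 0 < q) (hq2 : Even q)
    (hcop : Nat.Coprime (2 * l + 1) q) : ∃ w ∈ S,
      ((2 * l + 1 : ℕ) : ℚ[X]) * scaledEulerPoly (2 * l + 1) a k -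
        (-1) ^ a.natAbs * eulerPoly k - 2 * floorSum a k l q = 2 * (q : ℚ[X]) * w := by
  obtain ⟨D, hD, H⟩ := exists_natCast_mul_sub_floorSum_eq hX a k l
  obtain ⟨t, c, e, hc, hce⟩ := exists_pow_mul_of_pos q hD
  have hcop' : Nat.Coprime (2 * l + 1) (q ^ t) := hcop.pow_right t
  have hqt : 0 < q ^ t := pow_pos hq t
  obtain ⟨w, hw, h⟩ := H (q * q ^ t) (Nat.mul_pos hq hqt) (hq2.mul_right _)
    (hcop.mul_right hcop')
  obtain ⟨v, hv, h'⟩ := exists_floorSum_mul_eq hX a k l hq hq2 hqt hcop'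
  have hc0 : (c : ℚ) ≠ 0 := by
    rintro h0
    rw [Nat.cast_eq_zero.mp h0, Nat.coprime_zero_left] at hc
    subst hc
    exact absurd hq2 (by decide)
  have hr : C ((e : ℚ) / c) ∈ S := hS _ (by
    simpa using intCast_div_natCast_mem_ratIntegers (e : ℤ) hc)
  refine ⟨C ((e : ℚ) / c) * w + v, S.add_mem (S.mul_mem hr hw) hv, ?_⟩
  have hcr : (c : ℚ[X]) * C ((e : ℚ) / c) = e := by
    rw [← C_eq_natCast, ← C_mul, mul_div_cancel₀ _ hc0, C_eq_natCast]
  have hce' : (q : ℚ[X]) ^ t * c = D * e := by exact_mod_cast hce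
  have hD0 : (D : ℚ[X]) ≠ 0 := by exact_mod_cast hD.ne'
  have hcX : (c : ℚ[X]) ≠ 0 := by exact_mod_cast hc0
  refine mul_left_cancel₀ (mul_ne_zero hcX hD0) ?_
  push_cast at h ⊢
  rw [h'] at h
  linear_combination (c : ℚ[X]) * h + 2 * (q : ℚ[X]) * w * hce' - 2 * (q : ℚ[X]) * D * w * hcr

theorem stmt_6 (a : ℤ) (k : ℕ) (m q : ℕ) (hm : 0 < m) (hq : 0 < q) (hq2 : Even q)
    (hmq : Nat.Coprime m q) :
    ∃ g : Polynomial ℚ,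
      Polynomial.C ((m : ℚ) ^ (k + 1) / 2) *
          (eulerPoly k).comp
            (Polynomial.C (1 / (m : ℚ)) * (Polynomial.X + Polynomial.C (a : ℚ))) -
        Polynomial.C ((-1 : ℚ) ^ a.natAbs / 2) * eulerPoly k -
        (∑ j ∈ Finset.range q,
          Polynomial.C ((-1 : ℚ) ^ (j + 1) *
              ((⌊((a : ℚ) + j * m) / q⌋ : ℚ) + (1 - (m : ℚ)) / 2)) *
            (Polynomial.X + Polynomial.C ((a : ℚ) + j * m)) ^ k) =
      Polynomial.C (q : ℚ) * g ∧
      ∀ i : ℕ, ∃ b c : ℤ, 0 < c ∧ Int.gcd c q = 1 ∧ g.coeff i = (b : ℚ) / c := by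
  have hodd : Odd m := by
    rw [← Nat.not_even_iff_odd]
    intro h
    have := Nat.dvd_gcd h.two_dvd hq2.two_dvd
    rw [Nat.Coprime] at hmq
    omega
  obtain ⟨l, rfl⟩ := hodd
  obtain ⟨g, hg, h⟩ := exists_sub_floorSum_eq (S := liftsRing (ratIntegers q).subtype)
    ((lifts_iff_liftsRing _ _).mp (X_mem_lifts _))
    (fun r hr => (lifts_iff_liftsRing _ _).mp (C'_mem_lifts ⟨⟨r, hr⟩, rfl⟩)) a k l hq hq2 hmq
  refine ⟨g, ?_, fun i => ?_⟩
  · have hsum : (∑ j ∈ Finset.range q,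
          C ((-1 : ℚ) ^ (j + 1) * ((⌊((a : ℚ) + j * (2 * l + 1 : ℕ)) / q⌋ : ℚ) +
            (1 - ((2 * l + 1 : ℕ) : ℚ)) / 2)) *
            (X + C ((a : ℚ) + j * (2 * l + 1 : ℕ))) ^ k) = floorSum a k l q := by
      unfold floorSum
      refine Finset.sum_congr rfl fun j _ => ?_
      have hf : ⌊((a : ℚ) + j * (2 * l + 1 : ℕ)) / q⌋ =
          (a + j * (2 * l + 1 : ℕ)) / (q : ℤ) := by
        rw [← Rat.floor_intCast_div_natCast]
        push_cast
        rfl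
      have hl : (1 - ((2 * l + 1 : ℕ) : ℚ)) / 2 = -(l : ℚ) := by push_cast; ring
      rw [hf, hl]
      simp [sub_eq_add_neg, show (C 2 : ℚ[X]) = 2 from rfl]
    rw [hsum]
    refine mul_left_cancel₀ (two_ne_zero (α := ℚ[X])) ?_
    have h2 : (2 : ℚ[X]) * C (1 / 2) = 1 := by
      rw [show (2 : ℚ[X]) = C 2 from rfl, ← C_mul]; norm_num
    rw [scaledEulerPoly] at h
    rw [div_eq_mul_one_div, div_eq_mul_one_div ((-1 : ℚ) ^ _), pow_succ]
    simp only [C_mul, C_eq_natCast, C_pow, C_neg, C_1] at h ⊢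
    linear_combination h + ((2 * l + 1 : ℕ) ^ k * (2 * l + 1 : ℕ) *
      (eulerPoly k).comp (C (1 / ((2 * l + 1 : ℕ) : ℚ)) * (X + C (a : ℚ))) -
        (-1) ^ a.natAbs * eulerPoly k) * h2
  · obtain ⟨⟨r, hr⟩, hri⟩ :=
      (lifts_iff_coeff_lifts _).mp ((lifts_iff_liftsRing _ _).mpr hg) i
    refine ⟨r.num, r.den, by exact_mod_cast r.den_pos, ?_, ?_⟩
    · rw [Int.gcd_natCast_natCast]
      exact mem_ratIntegers_iff.mp hr
    · rw [← hri]
      exact_mod_cast (Rat.num_div_den r).symm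
end
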